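/- Buchsbaum–Eisenbud criterion for exactness: let R be a commutative Noetherian ring and let F_• : F₀ ←^{f₁} F₁ ←^{f₂} F₂ ← ⋯ ←^{f_n} F_n ← 0 be a complex of finitely generated free R-modules. Assume that (1) rank F_i = rank f_i + rank f_{i+1} for all 1 ≤ i ≤ n (with the convention f_{n+1} = 0), and (2) for each 1 ≤ i ≤ n, either I(f_i) = R or depth I(f_i) ≥ i. Then F_• is exact at F_i for every i ≥ 1. -/

import Mathlib

/-!
STATEMENT 6 (Buchsbaum–Eisenbud criterion for exactness): let `R` be a commutative
Noetherian ring and `F_• : F₀ ←f₁ F₁ ←f₂ F₂ ← ⋯ ←f_n F_n ← 0` a complex of finitely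
generated free `R`-modules such that
(1) `rank F_i = rank f_i + rank f_{i+1}` for `1 ≤ i ≤ n` (with `f_{n+1} = 0`), and
(2) for each `1 ≤ i ≤ n`, either `I(f_i) = R` or `depth I(f_i) ≥ i`.
Then `F_•` is exact at `F_i` for every `i ≥ 1`.

Here `rank f` is the largest `t` such that some `t × t` minor of a matrix of `f` is
nonzero, `I(f)` is the ideal of `(rank f) × (rank f)` minors of `f` (with `I(0) = 0`,
`rank 0 = 0`), and `depth I ≥ i` means that `I` contains an `R`-regular sequence of
length `i`.

Encoding: the free modules are `F i = Fin (b i) → R`, with `b i = 0` for `i > n` (so the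
complex stops at `F_n`), and `f_{i+1} = φ i : F (i+1) → F i`.
-/

noncomputable section

/-- The ideal generated by the `t × t` minors of a matrix. -/
def minorsIdeal {A : Type} [CommRing A] {a b : ℕ} (g : Matrix (Fin a) (Fin b) A)
    (t : ℕ) : Ideal A :=
  Ideal.span {x : A | ∃ (ρ : Fin t → Fin a) (c : Fin t → Fin b),
    x = Matrix.det (Matrix.of fun i j => g (ρ i) (c j))}

/-- `rank g`: the largest `t` such that some `t × t` minor of `g` is nonzero. -/
def matRank {A : Type} [CommRing A] {a b : ℕ} (g : Matrix (Fin a) (Fin b) A) : ℕ :=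
  sSup {t : ℕ | minorsIdeal g t ≠ ⊥}

/-- `I(g)`: the ideal of `(rank g) × (rank g)` minors of `g`, with the convention
`I(0) = 0` (note `rank g = 0` if and only if `g = 0`). -/
def detIdeal {A : Type} [CommRing A] {a b : ℕ} (g : Matrix (Fin a) (Fin b) A) : Ideal A :=
  if matRank g = 0 then ⊥ else minorsIdeal g (matRank g)

/-- `f₁,…,fₖ` is a regular sequence: `(f₁,…,fₖ) ≠ R` and each `fᵢ` is a nonzerodivisor
on `R/(f₁,…,f_{i−1})`. -/
def IsRegularSeq {A : Type} [CommRing A] {k : ℕ} (f : Fin k → A) : Prop :=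
  Ideal.span (Set.range f) ≠ ⊤ ∧
  ∀ (i : Fin k) (x : A), f i * x ∈ Ideal.span (f '' {j | j < i}) →
    x ∈ Ideal.span (f '' {j | j < i})

/-- `depth I ≥ n`: the ideal `I` contains a regular sequence of length `n`. -/
def depthGE {A : Type} [CommRing A] (I : Ideal A) (n : ℕ) : Prop :=
  ∃ f : Fin n → A, (∀ i, f i ∈ I) ∧ IsRegularSeq f

section
open Matrix

theorem minorsIdeal_eq_bot_of_matRank_lt {A : Type} [CommRing A] {a b : ℕ}
    (M : Matrix (Fin a) (Fin b) A) {t : ℕ} (ht : matRank M < t) : minorsIdeal M t = ⊥ := by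
  by_contra h
  refine absurd (le_csSup ?_ h) ht.not_ge
  refine ⟨b, fun u hu => ?_⟩
  by_contra! hbu
  refine hu (Ideal.span_eq_bot.2 ?_)
  rintro _ ⟨ρ, c, rfl⟩
  obtain ⟨i, j, hij, hc⟩ := Fintype.exists_ne_map_eq_of_card_lt c (by simpa using hbu)
  exact det_zero_of_column_eq hij fun k => by simp [hc]

theorem det_smul_sub_mul_adjugate_mul_eq_zero {A : Type} [CommRing A] {a b r : ℕ}
    (M : Matrix (Fin a) (Fin b) A) (hM : minorsIdeal M (r + 1) = ⊥)
    (ρ : Fin r → Fin a) (c : Fin r → Fin b) :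
    (M.submatrix ρ c).det • ((M.submatrix ρ c).det • M -
      M.submatrix id c * (M.submatrix ρ c).adjugate * M.submatrix ρ id) = 0 := by
  ext i j
  set B := M.submatrix ρ c with hB
  let u : Matrix (Fin r) Unit A := M.submatrix ρ fun _ => j
  let v : Matrix Unit (Fin r) A := M.submatrix (fun _ => i) c
  let d : Matrix Unit Unit A := M.submatrix (fun _ => i) fun _ => j
  have hdet : (fromBlocks B u v d).det = 0 := by
    let e : Fin (r + 1) ≃ Fin r ⊕ Unit := Fintype.equivOfCardEq (by simp)
    rw [← det_submatrix_equiv_self e, ← Ideal.mem_bot, ← hM]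
    refine Ideal.subset_span ⟨Sum.elim ρ (fun _ => i) ∘ e, Sum.elim c (fun _ => j) ∘ e, ?_⟩
    congr 1
    ext k l
    rcases hk : e k with k' | k' <;> rcases hl : e l with l' | l' <;> simp [hk, hl, B, u, v, d]
  have hmul : fromBlocks B u v d * fromBlocks 1 (-(B.adjugate * u)) 0 (B.det • 1) =
      fromBlocks B 0 v (B.det • d - v * B.adjugate * u) := by
    rw [fromBlocks_multiply]
    congr 1
    · simp
    · simp [← Matrix.mul_assoc, mul_adjugate]
    · simp
    · simp [Matrix.mul_assoc, sub_eq_neg_add]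
  have h := congrArg det hmul
  rw [det_mul, hdet, zero_mul, det_fromBlocks_zero₁₂, det_unique (n := Unit)] at h
  rw [Matrix.smul_apply, Matrix.zero_apply, smul_eq_mul, h]
  simp [Matrix.mul_apply, u, v, d]

theorem exists_minor_notMem {A : Type} [CommRing A] {a b t : ℕ} (M : Matrix (Fin a) (Fin b) A)
    {P : Ideal A} (h : ¬ minorsIdeal M t ≤ P) :
    ∃ (ρ : Fin t → Fin a) (c : Fin t → Fin b), (M.submatrix ρ c).det ∉ P := by
  contrapose! h
  refine Ideal.span_le.2 ?_
  rintro _ ⟨ρ, c, rfl⟩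
  exact h ρ c

theorem exists_retraction_coker {A : Type} [CommRing A] {a b : ℕ}
    (f : (Fin b → A) →ₗ[A] (Fin a → A)) {P : Ideal A} [P.IsPrime]
    (h : ¬ minorsIdeal (LinearMap.toMatrix' f) (matRank (LinearMap.toMatrix' f)) ≤ P) :
    ∃ s ∉ P, ∃ g : (Fin a → A) →ₗ[A] (Fin a → A), g ∘ₗ f = 0 ∧
      ∀ x, s • x - g x ∈ LinearMap.range f := by
  set M := LinearMap.toMatrix' f with hM
  obtain ⟨ρ, c, hs⟩ := exists_minor_notMem M h
  have hf : f = toLin' M := by simp [hM]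
  have key := det_smul_sub_mul_adjugate_mul_eq_zero M
    (minorsIdeal_eq_bot_of_matRank_lt M (Nat.lt_succ_self _)) ρ c
  set B := M.submatrix ρ c
  let C : Matrix (Fin b) (Fin a) A :=
    (1 : Matrix (Fin b) (Fin b) A).submatrix id c * B.adjugate *
      (1 : Matrix (Fin a) (Fin a) A).submatrix ρ id
  refine ⟨B.det * B.det, fun hm => hs ((or_self_iff).1 (Ideal.IsPrime.mem_or_mem ‹_› hm)),
    toLin' (B.det • (B.det • 1 - M * C)), ?_, fun x => ?_⟩
  · rw [hf, ← toLin'_mul, Matrix.smul_mul, Matrix.sub_mul, Matrix.smul_mul, Matrix.one_mul]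
    have : M * C * M = M.submatrix id c * B.adjugate * M.submatrix ρ id := by
      have h1 : M * (1 : Matrix (Fin b) (Fin b) A).submatrix id c = M.submatrix id c := by
        ext; simp [Matrix.mul_apply, Matrix.one_apply]
      have h2 : (1 : Matrix (Fin a) (Fin a) A).submatrix ρ id * M = M.submatrix ρ id := by
        ext; simp [Matrix.mul_apply, Matrix.one_apply]
      rw [← h1, ← h2]
      simp only [C, Matrix.mul_assoc]
    rw [this, key, map_zero]
  · refine ⟨B.det • (C *ᵥ x), ?_⟩
    rw [hf]
    simp [smul_sub, smul_smul]

theorem exists_smul_mem_range_of_rank_add_rank {A : Type} [CommRing A] {a b c : ℕ}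
    (f : (Fin b → A) →ₗ[A] (Fin a → A)) (g : (Fin c → A) →ₗ[A] (Fin b → A))
    (hfg : f ∘ₗ g = 0) {P : Ideal A} [P.IsPrime] {r t : ℕ} (hb : b = r + t)
    (hf : ¬ minorsIdeal (LinearMap.toMatrix' f) r ≤ P)
    (hg : ¬ minorsIdeal (LinearMap.toMatrix' g) t ≤ P) :
    ∃ s ∉ P, ∀ x, f x = 0 → s • x ∈ LinearMap.range g := by
  obtain ⟨ρ, κ, hB⟩ := exists_minor_notMem _ hf
  obtain ⟨ρ', κ', hB'⟩ := exists_minor_notMem _ hg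
  set M := LinearMap.toMatrix' f with hM
  set N := LinearMap.toMatrix' g with hN
  have hMN : M * N = 0 := by rw [hM, hN, ← LinearMap.toMatrix'_comp, hfg, map_zero]
  set B := M.submatrix ρ κ with hBdef
  set B' := N.submatrix ρ' κ' with hBdef'
  let e : Fin t ⊕ Fin r ≃ Fin b := Fintype.equivOfCardEq (by simp; omega)
  let E : Matrix (Fin b) (Fin r) A := (1 : Matrix (Fin b) (Fin b) A).submatrix id κ
  let W : Matrix (Fin b) (Fin t ⊕ Fin r) A := fromCols (N.submatrix id κ') E
  have hME : M.submatrix ρ id * E = B := by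
    ext; simp [Matrix.mul_apply, Matrix.one_apply, E, B]
  have hMW : M.submatrix ρ id * W = fromCols 0 B := by
    rw [mul_fromCols, hME]
    congr 1
    ext i j
    exact congrFun (congrFun hMN (ρ i)) (κ' j)
  let W' : Matrix (Fin t ⊕ Fin r) (Fin t ⊕ Fin r) A := W.submatrix e id
  have hW' : W'.det ∉ P := by
    intro hdet
    rw [← Ideal.Quotient.eq_zero_iff_mem, RingHom.map_det] at hdet hB hB'
    obtain ⟨v, hv, hv0⟩ := exists_mulVec_eq_zero_iff.2 hdet
    have hWv : W.map (Ideal.Quotient.mk P) *ᵥ v = 0 := by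
      funext i
      have h : (W.map (Ideal.Quotient.mk P) *ᵥ v) (e (e.symm i)) = 0 := congrFun hv0 (e.symm i)
      rwa [e.apply_symm_apply] at h
    have hr : v ∘ Sum.inr = 0 := by
      refine eq_zero_of_mulVec_eq_zero hB ?_
      have h := congrArg (fun X => X.map (Ideal.Quotient.mk P) *ᵥ v) hMW
      simp only [Matrix.map_mul, ← mulVec_mulVec, hWv, mulVec_zero] at h
      rw [show (fromCols (0 : Matrix (Fin r) (Fin t) A) B).map (Ideal.Quotient.mk P) =
        fromCols 0 (B.map (Ideal.Quotient.mk P)) by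
          ext i (j | j) <;> simp, fromCols_mulVec] at h
      simpa using h.symm
    have hl : v ∘ Sum.inl = 0 := by
      refine eq_zero_of_mulVec_eq_zero hB' ?_
      rw [show W.map (Ideal.Quotient.mk P) = fromCols ((N.submatrix id κ').map
        (Ideal.Quotient.mk P)) (E.map (Ideal.Quotient.mk P)) by
          ext i (j | j) <;> simp [W], fromCols_mulVec, hr, mulVec_zero, add_zero] at hWv
      funext i
      exact congrFun hWv (ρ' i)
    apply hv
    funext i
    rcases i with i | i
    · exact congrFun hl i
    · exact congrFun hr i
  refine ⟨B.det * W'.det, fun h => (Ideal.IsPrime.mem_or_mem ‹_› h).elim hB hW',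
    fun x hx => ?_⟩
  let y : Fin t ⊕ Fin r → A := W'.adjugate *ᵥ (x ∘ e)
  have hWy : W *ᵥ y = W'.det • x := by
    have h : W' *ᵥ y = W'.det • (x ∘ e) := by
      simp [y, mul_adjugate, smul_mulVec]
    funext i
    have hi : (W *ᵥ y) (e (e.symm i)) = W'.det • x (e (e.symm i)) := congrFun h (e.symm i)
    rwa [e.apply_symm_apply] at hi
  have hMx : M *ᵥ x = 0 := by rw [hM, LinearMap.toMatrix'_mulVec, hx]
  have hr : B.det • (y ∘ Sum.inr) = 0 := by
    have h := congrArg (· *ᵥ y) hMW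
    simp only [← mulVec_mulVec, hWy, mulVec_smul, fromCols_mulVec, zero_mulVec, zero_add] at h
    have h0 : M.submatrix ρ id *ᵥ x = 0 := by
      funext i
      exact congrFun hMx (ρ i)
    rw [h0, smul_zero] at h
    rw [← one_mulVec (y ∘ Sum.inr), ← smul_mulVec, ← adjugate_mul, ← mulVec_mulVec, ← h,
      mulVec_zero]
  refine ⟨(1 : Matrix (Fin c) (Fin c) A).submatrix id κ' *ᵥ (B.det • (y ∘ Sum.inl)), ?_⟩
  have hN1 : N * (1 : Matrix (Fin c) (Fin c) A).submatrix id κ' = N.submatrix id κ' := by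
    ext; simp [Matrix.mul_apply, Matrix.one_apply]
  rw [← LinearMap.toMatrix'_mulVec, ← hN, mulVec_mulVec, hN1, mul_smul, ← hWy, fromCols_mulVec,
    smul_add, ← mulVec_smul, ← mulVec_smul, hr, mulVec_zero, add_zero]
end

section
open CategoryTheory Abelian

theorem IsRegularSeq.isRegular_ofFn {A : Type} [CommRing A] {k : ℕ} {f : Fin k → A}
    (hf : IsRegularSeq f) : RingTheory.Sequence.IsRegular A (List.ofFn f) := by
  have hspan : ∀ i ≤ k, Ideal.ofList ((List.ofFn f).take i) • (⊤ : Submodule A A) =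
      Ideal.span (f '' {j | (j : ℕ) < i}) := by
    intro i hi
    rw [smul_eq_mul, Ideal.mul_top, Ideal.ofList]
    congr 1
    ext x
    simp only [Set.mem_ofPred_eq, List.mem_take_iff_getElem, Set.mem_image]
    constructor
    · rintro ⟨j, hj, rfl⟩
      simp only [List.length_ofFn, lt_min_iff] at hj
      exact ⟨⟨j, hj.2⟩, hj.1, by simp⟩
    · rintro ⟨j, hj, rfl⟩
      exact ⟨j, by simp [hj], by simp⟩
  refine ⟨⟨fun i hi => ?_⟩, ?_⟩
  · simp only [List.length_ofFn] at hi
    rw [hspan i hi.le, isSMulRegular_iff_right_eq_zero_of_smul]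
    intro x hx
    obtain ⟨x, rfl⟩ := Submodule.Quotient.mk_surjective _ x
    rw [← Submodule.Quotient.mk_smul, Submodule.Quotient.mk_eq_zero] at hx
    rw [Submodule.Quotient.mk_eq_zero]
    refine hf.2 ⟨i, hi⟩ x ?_
    rw [List.getElem_ofFn, smul_eq_mul] at hx
    exact hx
  · have h := hspan k le_rfl
    rw [List.take_of_length_le (by simp)] at h
    rw [h]
    have : {j : Fin k | (j : ℕ) < k} = Set.univ := by ext j; simp
    rw [this, Set.image_univ]
    exact hf.1.symm

theorem subsingleton_ext_quotient_pi {A : Type} [CommRing A] [IsNoetherianRing A] {P : Ideal A}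
    (hP : P ≠ ⊤) {k : ℕ} (h : depthGE P k) (m l : ℕ) (hl : l < k) :
    Subsingleton (Ext (ModuleCat.of A (A ⧸ P)) (ModuleCat.of A (Fin m → A)) l) := by
  obtain ⟨f, hfP, hf⟩ := h
  have hA : Subsingleton (Ext (ModuleCat.of A (A ⧸ P)) (ModuleCat.of A A) l) := by
    refine ModuleCat.subsingleton_ext_of_exists_isRegular P (ModuleCat.of A (A ⧸ P)) ?_
      (ModuleCat.of A A) ?_ (List.ofFn f) ?_ hf.isRegular_ofFn l (by simpa using hl)
    · change Module.support A (A ⧸ P) ⊆ _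
      rw [Module.support_eq_zeroLocus, Ideal.annihilator_quotient]
    · change P • (⊤ : Submodule A A) < ⊤
      rw [smul_eq_mul, Ideal.mul_top]
      exact hP.lt_top
    · intro r hr
      obtain ⟨i, rfl⟩ := (List.mem_ofFn' _ _).1 hr
      exact hfP i
  refine subsingleton_of_forall_eq 0 fun e => ?_
  have hid : 𝟙 (ModuleCat.of A (Fin m → A)) = ∑ i : Fin m,
      (ModuleCat.ofHom (LinearMap.proj (R := A) (φ := fun _ : Fin m => A) i) ≫
        ModuleCat.ofHom (LinearMap.single A (fun _ : Fin m => A) i)) := by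
    apply ModuleCat.hom_ext
    rw [ModuleCat.hom_sum]
    refine LinearMap.ext fun x => ?_
    rw [LinearMap.sum_apply]
    exact (LinearMap.sum_single_apply _ x).symm
  rw [← Ext.comp_mk₀_id e, hid, Ext.mk₀_sum, Ext.comp_sum]
  refine Finset.sum_eq_zero fun i _ => ?_
  rw [← Ext.mk₀_comp_mk₀, ← Ext.comp_assoc_of_third_deg_zero,
    Subsingleton.elim (e.comp (Ext.mk₀ _) (add_zero l)) 0, Ext.zero_comp]

theorem smul_ext_eq_zero_of_shortExact {A : Type} [CommRing A] {X : ModuleCat.{0} A}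
    {S : ShortComplex (ModuleCat.{0} A)} (hS : S.ShortExact) {s : A} {l : ℕ}
    (h₂ : Subsingleton (Ext X S.X₂ l)) (h₁ : ∀ e : Ext X S.X₁ (l + 1), s • e = 0)
    (e : Ext X S.X₃ l) : s • e = 0 := by
  obtain ⟨x, hx⟩ := Ext.covariant_sequence_exact₃ X hS (s • e) rfl (by rw [Ext.smul_comp, h₁])
  rw [← hx, Subsingleton.elim x 0, Ext.zero_comp]

theorem smul_ext_eq_zero_of_factors {A : Type} [CommRing A] {X Y Z : ModuleCat.{0} A}
    (σ : Y ⟶ Z) (π : Z ⟶ Y) {s : A} (h : σ ≫ π = s • 𝟙 Y) {l : ℕ}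
    (hZ : Subsingleton (Ext X Z l)) (e : Ext X Y l) : s • e = 0 := by
  rw [Ext.smul_eq_comp_mk₀, ← h, ← Ext.mk₀_comp_mk₀, ← Ext.comp_assoc_of_third_deg_zero,
    Subsingleton.elim (e.comp (Ext.mk₀ σ) (add_zero l)) 0, Ext.zero_comp]

theorem smul_ext_quotient_range_eq_zero {A : Type} [CommRing A] {X : ModuleCat.{0} A}
    {G F E : Type} [AddCommGroup G] [AddCommGroup F] [AddCommGroup E] [Module A G] [Module A F]
    [Module A E] (f : F →ₗ[A] E) (g : G →ₗ[A] F) (hfg : LinearMap.ker f = LinearMap.range g)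
    {s : A} {l : ℕ} (hE : Subsingleton (Ext X (ModuleCat.of A E) l))
    (h : ∀ e : Ext X (ModuleCat.of A (F ⧸ LinearMap.range g)) (l + 1), s • e = 0)
    (e : Ext X (ModuleCat.of A (E ⧸ LinearMap.range f)) l) : s • e = 0 := by
  let ι : F ⧸ LinearMap.range g →ₗ[A] E := (LinearMap.range g).liftQ f hfg.ge
  let S : ShortComplex (ModuleCat.{0} A) := ShortComplex.mk (ModuleCat.ofHom ι)
    (ModuleCat.ofHom (LinearMap.range f).mkQ) (by
      ext x
      simp [ι])
  have hS : S.ShortExact := by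
    refine ModuleCat.shortComplex_shortExact _ ?_ ?_ ?_
    · change Function.Exact ι (LinearMap.range f).mkQ
      rw [LinearMap.exact_iff, Submodule.ker_mkQ, Submodule.range_liftQ]
    · change Function.Injective ι
      rw [← LinearMap.ker_eq_bot]
      exact Submodule.ker_liftQ_eq_bot _ _ _ hfg.le
    · exact Submodule.mkQ_surjective _
  exact smul_ext_eq_zero_of_shortExact hS hE h e

theorem smul_eq_zero_of_smul_ext_zero {A : Type} [CommRing A] {P : Ideal A} {N : Type}
    [AddCommGroup N] [Module A N] {s : A}
    (h : ∀ e : Ext (ModuleCat.of A (A ⧸ P)) (ModuleCat.of A N) 0, s • e = 0)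
    {x : N} (hx : ∀ a ∈ P, a • x = 0) : s • x = 0 := by
  let f : A ⧸ P →ₗ[A] N := Submodule.liftQ P (LinearMap.toSpanSingleton A N x) hx
  have h1 := h (Ext.mk₀ (ModuleCat.ofHom f))
  rw [← Ext.mk₀_smul, Ext.mk₀_eq_zero_iff] at h1
  have h2 : s • f (Submodule.Quotient.mk 1) = 0 :=
    congrArg (fun φ => φ.hom (Submodule.Quotient.mk (1 : A))) h1
  rwa [show f (Submodule.Quotient.mk 1) = x from
    (Submodule.liftQ_apply P _ 1).trans (one_smul A x)] at h2
end

theorem le_of_forall_isPrime_smul_mem {A F : Type} [CommRing A] [IsNoetherianRing A]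
    [AddCommGroup F] [Module A F] (K N : Submodule A F)
    (h : ∀ P : Ideal A, P.IsPrime → ∀ x ∈ K, ¬ ∀ a, a ∈ P ↔ a • x ∈ N) : K ≤ N := by
  intro x hx
  by_contra hxN
  have hne : (Submodule.Quotient.mk ⟨x, hx⟩ : K ⧸ N.comap K.subtype) ≠ 0 := by
    rw [Ne, Submodule.Quotient.mk_eq_zero]
    exact hxN
  obtain ⟨P, hP, -⟩ := exists_le_isAssociatedPrime_of_isNoetherianRing A _ hne
  obtain ⟨hPp, y, hy⟩ := isAssociatedPrime_iff.1 hP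
  obtain ⟨y, rfl⟩ := Submodule.Quotient.mk_surjective _ y
  refine h P hPp y y.2 fun a => ?_
  rw [hy, Submodule.mem_colon_singleton, Submodule.mem_bot, ← Submodule.Quotient.mk_smul,
    Submodule.Quotient.mk_eq_zero]
  rfl

theorem detIdeal_le_minorsIdeal {A : Type} [CommRing A] {a b : ℕ}
    (M : Matrix (Fin a) (Fin b) A) : detIdeal M ≤ minorsIdeal M (matRank M) := by
  unfold detIdeal
  split_ifs
  · exact bot_le
  · exact le_rfl

theorem minorsIdeal_matRank_eq_top_of_isEmpty {A : Type} [CommRing A] {a b : ℕ}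
    (M : Matrix (Fin a) (Fin b) A) (hb : b = 0) : minorsIdeal M (matRank M) = ⊤ := by
  have hr : matRank M = 0 := by
    refine Nat.le_zero.1 (csSup_le' fun t ht => ?_)
    by_contra! h0
    refine ht (Ideal.span_eq_bot.2 ?_)
    rintro _ ⟨ρ, c, rfl⟩
    exact absurd (c ⟨0, h0⟩).2 (by omega)
  rw [hr, Ideal.eq_top_iff_one]
  exact Ideal.subset_span ⟨Fin.elim0, Fin.elim0, by simp⟩

theorem depthGE.mono {A : Type} [CommRing A] {I J : Ideal A} (hIJ : I ≤ J) {k : ℕ}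
    (h : depthGE I k) : depthGE J k :=
  let ⟨f, hfI, hf⟩ := h
  ⟨f, fun i => hIJ (hfI i), hf⟩

open CategoryTheory Abelian in
theorem exists_smul_ext_coker_eq_zero {A : Type} [CommRing A] [IsNoetherianRing A] {a b k : ℕ}
    (f : (Fin b → A) →ₗ[A] (Fin a → A)) {P : Ideal A} [hP : P.IsPrime]
    (h : ¬ minorsIdeal (LinearMap.toMatrix' f) (matRank (LinearMap.toMatrix' f)) ≤ P)
    (hk : depthGE P k) :
    ∃ s ∉ P, ∀ l < k, ∀ e : Ext (ModuleCat.of A (A ⧸ P))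
      (ModuleCat.of A ((Fin a → A) ⧸ LinearMap.range f)) l, s • e = 0 := by
  obtain ⟨s, hs, g, hgf, hg⟩ := exists_retraction_coker f h
  refine ⟨s, hs, fun l hl e => ?_⟩
  let σ : ((Fin a → A) ⧸ LinearMap.range f) →ₗ[A] (Fin a → A) :=
    (LinearMap.range f).liftQ g (LinearMap.range_le_ker_iff.2 hgf)
  refine smul_ext_eq_zero_of_factors (Z := ModuleCat.of A (Fin a → A)) (ModuleCat.ofHom σ)
    (ModuleCat.ofHom (LinearMap.range f).mkQ) ?_ (subsingleton_ext_quotient_pi hP.ne_top hk a l hl) e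
  apply ModuleCat.hom_ext
  refine Submodule.linearMap_qext _ (LinearMap.ext fun x => ?_)
  exact ((Submodule.Quotient.eq _).2 (hg x)).symm

theorem ker_eq_range_of_forall_lt {A : Type} [CommRing A]
    [IsNoetherianRing A] (n : ℕ) (b : ℕ → ℕ) (hb : ∀ i, n < i → b i = 0)
    (φ : ∀ i : ℕ, (Fin (b (i + 1)) → A) →ₗ[A] (Fin (b i) → A))
    (hcomplex : ∀ i, (φ i).comp (φ (i + 1)) = 0)
    (hrank : ∀ i, i < n →
      b (i + 1) = matRank (LinearMap.toMatrix' (φ i)) +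
        matRank (LinearMap.toMatrix' (φ (i + 1))))
    (hdepth : ∀ i, i < n →
      detIdeal (LinearMap.toMatrix' (φ i)) = ⊤ ∨
        depthGE (detIdeal (LinearMap.toMatrix' (φ i))) (i + 1))
    {i : ℕ} (hi : i < n)
    (hex : ∀ j, i < j → LinearMap.ker (φ j) = LinearMap.range (φ (j + 1))) :
    LinearMap.ker (φ i) = LinearMap.range (φ (i + 1)) := by
  refine le_antisymm (le_of_forall_isPrime_smul_mem _ _ fun P hP x hx hPx => ?_)
    (LinearMap.range_le_ker_iff.2 (hcomplex i))
  let J : ℕ → Ideal A := fun k =>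
    minorsIdeal (LinearMap.toMatrix' (φ k)) (matRank (LinearMap.toMatrix' (φ k)))
  suffices ∃ s ∉ P, s • x ∈ LinearMap.range (φ (i + 1)) by
    obtain ⟨s, hs, hsx⟩ := this
    exact hs ((hPx s).2 hsx)
  have hJn : ∀ k, J k ≤ P → k < n := by
    intro k hk
    by_contra! hnk
    refine hP.ne_top (top_le_iff.1 (le_trans (ge_of_eq ?_) hk))
    exact minorsIdeal_matRank_eq_top_of_isEmpty _ (hb _ (by omega))
  by_cases hJ : ∃ k, i ≤ k ∧ J k ≤ P
  · obtain ⟨k, ⟨hik, hkP⟩, hmax⟩ : ∃ k, (i ≤ k ∧ J k ≤ P) ∧ ∀ m, k < m → ¬ J m ≤ P := by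
      classical
      obtain ⟨k₀, hk₀⟩ := hJ
      have hspec := Nat.findGreatest_spec (P := fun k => i ≤ k ∧ J k ≤ P)
        (hJn k₀ hk₀.2).le hk₀
      refine ⟨_, hspec, fun m hm hmP => ?_⟩
      exact Nat.findGreatest_is_greatest hm (hJn m hmP).le ⟨hspec.1.trans hm.le, hmP⟩
    have hdP : depthGE P (k + 1) := by
      have hle := (detIdeal_le_minorsIdeal (LinearMap.toMatrix' (φ k))).trans hkP
      rcases hdepth k (hJn k hkP) with h | h
      · exact absurd (top_le_iff.1 (h ▸ hle)) hP.ne_top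
      · exact h.mono hle
    obtain ⟨s, hs, hext⟩ := exists_smul_ext_coker_eq_zero (φ (k + 1))
      (hmax (k + 1) (Nat.lt_succ_self k)) hdP
    have hdesc : ∀ j ≤ k, i ≤ j → ∀ l < j + 1, ∀ e : CategoryTheory.Abelian.Ext
        (ModuleCat.of A (A ⧸ P))
        (ModuleCat.of A ((Fin (b (j + 1)) → A) ⧸ LinearMap.range (φ (j + 1)))) l, s • e = 0 := by
      intro j hjk
      induction hjk using Nat.decreasingInduction with
      | self => exact fun _ => hext
      | of_succ j hj ih =>
        intro hij l hl
        exact smul_ext_quotient_range_eq_zero (φ (j + 1)) (φ (j + 1 + 1)) (hex (j + 1) (by omega))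
          (subsingleton_ext_quotient_pi hP.ne_top hdP _ l (by omega))
          (ih (by omega) (l + 1) (by omega))
    refine ⟨s, hs, ?_⟩
    rw [← Submodule.Quotient.mk_eq_zero, Submodule.Quotient.mk_smul]
    refine smul_eq_zero_of_smul_ext_zero (hdesc i hik le_rfl 0 (Nat.succ_pos i)) fun a ha => ?_
    rw [← Submodule.Quotient.mk_smul, Submodule.Quotient.mk_eq_zero]
    exact (hPx a).1 ha
  · push Not at hJ
    obtain ⟨s, hs, h⟩ := exists_smul_mem_range_of_rank_add_rank (φ i) (φ (i + 1)) (hcomplex i)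
      (hrank i hi) (hJ i le_rfl) (hJ (i + 1) (Nat.le_succ i))
    exact ⟨s, hs, h x hx⟩

/-- **Buchsbaum–Eisenbud criterion for exactness.**
`F_• : F₀ ← F₁ ← ⋯ ← F_n ← 0` is a complex of finitely generated free modules over a
commutative Noetherian ring, `F i := Fin (b i) → A` (with `b i = 0` for `i > n`), with
differentials `f_{i+1} = φ i : F (i+1) → F i` satisfying `φ i ∘ φ (i+1) = 0`.  If
(1) `rank F_{i+1} = rank f_{i+1} + rank f_{i+2}` for each `i+1 ≤ n`, and
(2) for each `i+1 ≤ n`, either `I(f_{i+1}) = R` or `depth I(f_{i+1}) ≥ i+1`,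
then `F_•` is exact at `F_i` for every `i ≥ 1`, i.e. `ker (φ i) = range (φ (i+1))`
for all `i`. -/
theorem buchsbaum_eisenbud_exactness_criterion {A : Type} [CommRing A]
    [IsNoetherianRing A] (n : ℕ) (b : ℕ → ℕ) (hb : ∀ i, n < i → b i = 0)
    (φ : ∀ i : ℕ, (Fin (b (i + 1)) → A) →ₗ[A] (Fin (b i) → A))
    (hcomplex : ∀ i, (φ i).comp (φ (i + 1)) = 0)
    (hrank : ∀ i, i < n →
      b (i + 1) = matRank (LinearMap.toMatrix' (φ i)) +
        matRank (LinearMap.toMatrix' (φ (i + 1))))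
    (hdepth : ∀ i, i < n →
      detIdeal (LinearMap.toMatrix' (φ i)) = ⊤ ∨
        depthGE (detIdeal (LinearMap.toMatrix' (φ i))) (i + 1)) :
    ∀ i, LinearMap.ker (φ i) = LinearMap.range (φ (i + 1)) := by
  have main : ∀ m i, n ≤ i + m → LinearMap.ker (φ i) = LinearMap.range (φ (i + 1)) := by
    intro m
    induction m with
    | zero =>
      intro i hi
      have : IsEmpty (Fin (b (i + 1))) := by
        rw [hb (i + 1) (by omega)]
        infer_instance
      exact Subsingleton.elim _ _
    | succ m ih =>
      intro i hi
      rcases lt_or_ge i n with hin | hin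
      · exact ker_eq_range_of_forall_lt n b hb φ hcomplex hrank hdepth hin
          fun j hj => ih j (by omega)
      · exact ih i (by omega)
  exact fun i => main n i (by omega)

end
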